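/- locate preserves meaning on sequences starting with the located kind: for every LL(1) focused syntax (s, c) and token t with kind t = k, if locate k (s, c) = some (s', c'), then for all token sequences ts and values v, Matches (unfocus (s', c')) (t :: ts) v if and only if Matches (unfocus (s, c)) (t :: ts) v. -/

import Mathlib

set_option autoImplicit false

/-- Context-free syntaxes (value-aware context-free expressions). -/
inductive Syn (Token Kind : Type) (Var : Type → Type) : Type → Type 1 where
  | elem (k : Kind) : Syn Token Kind Var Token
  | fail {A : Type} : Syn Token Kind Var A
  | eps {A : Type} (v : A) : Syn Token Kind Var A
  | disj {A : Type} (s₁ s₂ : Syn Token Kind Var A) : Syn Token Kind Var A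
  | seqn {A B : Type} (s₁ : Syn Token Kind Var A) (s₂ : Syn Token Kind Var B) :
      Syn Token Kind Var (A × B)
  | map {A B : Type} (f : A → B) (s : Syn Token Kind Var A) : Syn Token Kind Var B
  | var {A : Type} (x : Var A) : Syn Token Kind Var A

section

variable {Token Kind : Type} {Var : Type → Type}
variable (kd : Token → Kind) (env : ∀ A : Type, Var A → Syn Token Kind Var A)

/-- Semantics of syntaxes. -/
inductive Matches : ∀ {A : Type}, Syn Token Kind Var A → List Token → A → Prop where
  | elem {k : Kind} {t : Token} (h : kd t = k) : Matches (Syn.elem k) [t] t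
  | eps {A : Type} (v : A) : Matches (Syn.eps v) [] v
  | disjL {A : Type} {s₁ s₂ : Syn Token Kind Var A} {ts : List Token} {v : A} :
      Matches s₁ ts v → Matches (Syn.disj s₁ s₂) ts v
  | disjR {A : Type} {s₁ s₂ : Syn Token Kind Var A} {ts : List Token} {v : A} :
      Matches s₂ ts v → Matches (Syn.disj s₁ s₂) ts v
  | seqn {A B : Type} {s₁ : Syn Token Kind Var A} {s₂ : Syn Token Kind Var B}
      {ts₁ ts₂ : List Token} {v₁ : A} {v₂ : B} :
      Matches s₁ ts₁ v₁ → Matches s₂ ts₂ v₂ →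
      Matches (Syn.seqn s₁ s₂) (ts₁ ++ ts₂) (v₁, v₂)
  | map {A B : Type} (f : A → B) {s : Syn Token Kind Var A} {ts : List Token} {v : A} :
      Matches s ts v → Matches (Syn.map f s) ts (f v)
  | var {A : Type} (x : Var A) {ts : List Token} {v : A} :
      Matches (env A x) ts v → Matches (Syn.var x) ts v

/-- Productivity. -/
inductive Productive : ∀ {A : Type}, Syn Token Kind Var A → Prop where
  | eps {A : Type} (v : A) : Productive (Syn.eps v)
  | elem (k : Kind) : Productive (Syn.elem k)
  | disjL {A : Type} {s₁ s₂ : Syn Token Kind Var A} :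
      Productive s₁ → Productive (Syn.disj s₁ s₂)
  | disjR {A : Type} {s₁ s₂ : Syn Token Kind Var A} :
      Productive s₂ → Productive (Syn.disj s₁ s₂)
  | seqn {A B : Type} {s₁ : Syn Token Kind Var A} {s₂ : Syn Token Kind Var B} :
      Productive s₁ → Productive s₂ → Productive (Syn.seqn s₁ s₂)
  | map {A B : Type} (f : A → B) {s : Syn Token Kind Var A} :
      Productive s → Productive (Syn.map f s)
  | var {A : Type} (x : Var A) : Productive (env A x) → Productive (Syn.var x)

/-- Nullability, with associated value. -/
inductive Nullable : ∀ {A : Type}, Syn Token Kind Var A → A → Prop where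
  | eps {A : Type} (v : A) : Nullable (Syn.eps v) v
  | disjL {A : Type} {s₁ s₂ : Syn Token Kind Var A} {v : A} :
      Nullable s₁ v → Nullable (Syn.disj s₁ s₂) v
  | disjR {A : Type} {s₁ s₂ : Syn Token Kind Var A} {v : A} :
      Nullable s₂ v → Nullable (Syn.disj s₁ s₂) v
  | seqn {A B : Type} {s₁ : Syn Token Kind Var A} {s₂ : Syn Token Kind Var B} {v₁ : A} {v₂ : B} :
      Nullable s₁ v₁ → Nullable s₂ v₂ → Nullable (Syn.seqn s₁ s₂) (v₁, v₂)
  | map {A B : Type} (f : A → B) {s : Syn Token Kind Var A} {v : A} :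
      Nullable s v → Nullable (Syn.map f s) (f v)
  | var {A : Type} (x : Var A) {v : A} : Nullable (env A x) v → Nullable (Syn.var x) v

/-- First sets: `InFirst env k s` means `k ∈ First s`. -/
inductive InFirst : ∀ {A : Type}, Kind → Syn Token Kind Var A → Prop where
  | elem (k : Kind) : InFirst k (Syn.elem k)
  | disjL {A : Type} {k : Kind} {s₁ s₂ : Syn Token Kind Var A} :
      InFirst k s₁ → InFirst k (Syn.disj s₁ s₂)
  | disjR {A : Type} {k : Kind} {s₁ s₂ : Syn Token Kind Var A} :
      InFirst k s₂ → InFirst k (Syn.disj s₁ s₂)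
  | seqnL {A B : Type} {k : Kind} {s₁ : Syn Token Kind Var A} {s₂ : Syn Token Kind Var B} :
      InFirst k s₁ → Productive env s₂ → InFirst k (Syn.seqn s₁ s₂)
  | seqnR {A B : Type} {k : Kind} {s₁ : Syn Token Kind Var A} {s₂ : Syn Token Kind Var B}
      {v : A} : Nullable env s₁ v → InFirst k s₂ → InFirst k (Syn.seqn s₁ s₂)
  | map {A B : Type} {k : Kind} (f : A → B) {s : Syn Token Kind Var A} :
      InFirst k s → InFirst k (Syn.map f s)
  | var {A : Type} {k : Kind} (x : Var A) : InFirst k (env A x) → InFirst k (Syn.var x)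

/-- Should-not-follow sets: `InSNF env k s` means `k ∈ ShouldNotFollow s`. -/
inductive InSNF : ∀ {A : Type}, Kind → Syn Token Kind Var A → Prop where
  | disjL {A : Type} {k : Kind} {s₁ s₂ : Syn Token Kind Var A} :
      InSNF k s₁ → InSNF k (Syn.disj s₁ s₂)
  | disjR {A : Type} {k : Kind} {s₁ s₂ : Syn Token Kind Var A} :
      InSNF k s₂ → InSNF k (Syn.disj s₁ s₂)
  | disjFN {A : Type} {k : Kind} {s₁ s₂ : Syn Token Kind Var A} {v : A} :
      InFirst env k s₁ → Nullable env s₂ v → InSNF k (Syn.disj s₁ s₂)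
  | disjNF {A : Type} {k : Kind} {s₁ s₂ : Syn Token Kind Var A} {v : A} :
      Nullable env s₁ v → InFirst env k s₂ → InSNF k (Syn.disj s₁ s₂)
  | seqnL {A B : Type} {k : Kind} {s₁ : Syn Token Kind Var A} {s₂ : Syn Token Kind Var B}
      {v : B} : InSNF k s₁ → Nullable env s₂ v → InSNF k (Syn.seqn s₁ s₂)
  | seqnR {A B : Type} {k : Kind} {s₁ : Syn Token Kind Var A} {s₂ : Syn Token Kind Var B} :
      Productive env s₁ → InSNF k s₂ → InSNF k (Syn.seqn s₁ s₂)
  | map {A B : Type} {k : Kind} (f : A → B) {s : Syn Token Kind Var A} :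
      InSNF k s → InSNF k (Syn.map f s)
  | var {A : Type} {k : Kind} (x : Var A) : InSNF k (env A x) → InSNF k (Syn.var x)

/-- LL(1) conflicts. A syntax `s` is LL(1) iff `¬ HasConflict env s`. -/
inductive HasConflict : ∀ {A : Type}, Syn Token Kind Var A → Prop where
  | disjNN {A : Type} {s₁ s₂ : Syn Token Kind Var A} {v₁ v₂ : A} :
      Nullable env s₁ v₁ → Nullable env s₂ v₂ → HasConflict (Syn.disj s₁ s₂)
  | disjFF {A : Type} {s₁ s₂ : Syn Token Kind Var A} {k : Kind} :
      InFirst env k s₁ → InFirst env k s₂ → HasConflict (Syn.disj s₁ s₂)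
  | disjL {A : Type} {s₁ s₂ : Syn Token Kind Var A} :
      HasConflict s₁ → HasConflict (Syn.disj s₁ s₂)
  | disjR {A : Type} {s₁ s₂ : Syn Token Kind Var A} :
      HasConflict s₂ → HasConflict (Syn.disj s₁ s₂)
  | seqnSF {A B : Type} {s₁ : Syn Token Kind Var A} {s₂ : Syn Token Kind Var B} {k : Kind} :
      InSNF env k s₁ → InFirst env k s₂ → HasConflict (Syn.seqn s₁ s₂)
  | seqnL {A B : Type} {s₁ : Syn Token Kind Var A} {s₂ : Syn Token Kind Var B} :
      HasConflict s₁ → HasConflict (Syn.seqn s₁ s₂)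
  | seqnR {A B : Type} {s₁ : Syn Token Kind Var A} {s₂ : Syn Token Kind Var B} :
      HasConflict s₂ → HasConflict (Syn.seqn s₁ s₂)
  | map {A B : Type} (f : A → B) {s : Syn Token Kind Var A} :
      HasConflict s → HasConflict (Syn.map f s)
  | var {A : Type} (x : Var A) : HasConflict (env A x) → HasConflict (Syn.var x)

end

/-- Layers of a context, with above type `A` and below type `B`. -/
inductive Layer (Token Kind : Type) (Var : Type → Type) : Type → Type → Type 1 where
  | apply {A B : Type} (f : A → B) : Layer Token Kind Var A B
  | prepend {A C : Type} (v : C) : Layer Token Kind Var A (C × A)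
  | followBy {A C : Type} (s : Syn Token Kind Var C) : Layer Token Kind Var A (A × C)

/-- Type-aligned contexts (stacks of layers). -/
inductive Ctx (Token Kind : Type) (Var : Type → Type) : Type → Type → Type 1 where
  | nil {A : Type} : Ctx Token Kind Var A A
  | cons {A B C : Type} (l : Layer Token Kind Var A B) (c : Ctx Token Kind Var B C) :
      Ctx Token Kind Var A C

section

variable {Token Kind : Type} {Var : Type → Type}

def Ctx.isNil : ∀ {A B : Type}, Ctx Token Kind Var A B → Bool
  | _, _, Ctx.nil => true
  | _, _, Ctx.cons _ _ => false

/-- Unfocusing a focused syntax. -/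
def unfocus : ∀ {A B : Type}, Syn Token Kind Var A → Ctx Token Kind Var A B →
    Syn Token Kind Var B
  | _, _, s, Ctx.nil => s
  | _, _, s, Ctx.cons (Layer.apply f) c => unfocus (Syn.map f s) c
  | _, _, s, Ctx.cons (Layer.prepend v) c => unfocus (Syn.seqn (Syn.eps v) s) c
  | _, _, s, Ctx.cons (Layer.followBy s') c => unfocus (Syn.seqn s s') c

/-- Focused syntaxes with below type `B`. -/
def Focused (Token Kind : Type) (Var : Type → Type) (B : Type) : Type 1 :=
  (A : Type) × Syn Token Kind Var A × Ctx Token Kind Var A B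

def unfocusF {B : Type} (fs : Focused Token Kind Var B) : Syn Token Kind Var B :=
  unfocus fs.2.1 fs.2.2

def focusF {A : Type} (s : Syn Token Kind Var A) : Focused Token Kind Var A :=
  ⟨A, s, Ctx.nil⟩

/-- Plugging a value into a context. -/
def plug : ∀ {A B : Type}, A → Ctx Token Kind Var A B → Focused Token Kind Var B
  | A, _, v, Ctx.nil => ⟨A, Syn.eps v, Ctx.nil⟩
  | _, _, v, Ctx.cons (Layer.apply f) c => plug (f v) c
  | _, _, v, Ctx.cons (Layer.prepend v') c => plug (v', v) c
  | _, _, v, Ctx.cons (Layer.followBy s) c => ⟨_, s, Ctx.cons (Layer.prepend v) c⟩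

end

section Helpers

variable {Token Kind : Type} {Var : Type → Type}
variable (kd : Token → Kind) (env : ∀ A : Type, Var A → Syn Token Kind Var A)

def MInv : ∀ {A : Type}, Syn Token Kind Var A → List Token → A → Prop
  | _, Syn.eps w, ts, v => ts = [] ∧ v = w
  | _, Syn.seqn s₁ s₂, ts, v => ∃ ts₁ ts₂, ts = ts₁ ++ ts₂ ∧
      Matches kd env s₁ ts₁ v.1 ∧ Matches kd env s₂ ts₂ v.2
  | _, Syn.map f s, ts, v => ∃ w, v = f w ∧ Matches kd env s ts w
  | _, _, _, _ => True

theorem mInv {A : Type} {s : Syn Token Kind Var A} {ts : List Token} {v : A}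
    (h : Matches kd env s ts v) : MInv kd env s ts v := by
  induction h with
  | elem h => trivial
  | eps v => exact ⟨rfl, rfl⟩
  | disjL _ _ => trivial
  | disjR _ _ => trivial
  | seqn h₁ h₂ _ _ => exact ⟨_, _, rfl, h₁, h₂⟩
  | map f h _ => exact ⟨_, rfl, h⟩
  | var x _ _ => trivial

def PInv : ∀ {A : Type}, Syn Token Kind Var A → Prop
  | _, Syn.seqn s₁ s₂ => Productive env s₁ ∧ Productive env s₂
  | _, Syn.map _ s => Productive env s
  | _, _ => True

theorem pInv {A : Type} {s : Syn Token Kind Var A}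
    (h : Productive env s) : PInv env s := by
  induction h with
  | seqn h₁ h₂ _ _ => exact ⟨h₁, h₂⟩
  | map f h _ => exact h
  | _ => trivial

def NInv : ∀ {A : Type}, Syn Token Kind Var A → A → Prop
  | _, Syn.eps w, v => v = w
  | _, Syn.seqn s₁ s₂, v => Nullable env s₁ v.1 ∧ Nullable env s₂ v.2
  | _, Syn.map f s, v => ∃ w, v = f w ∧ Nullable env s w
  | _, _, _ => True

theorem nInv {A : Type} {s : Syn Token Kind Var A} {v : A}
    (h : Nullable env s v) : NInv env s v := by
  induction h with
  | eps v => exact rfl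
  | seqn h₁ h₂ _ _ => exact ⟨h₁, h₂⟩
  | map f h _ => exact ⟨_, rfl, h⟩
  | _ => trivial

def FInv : ∀ {A : Type}, Kind → Syn Token Kind Var A → Prop
  | _, _, Syn.eps _ => False
  | _, k, Syn.seqn s₁ s₂ => (InFirst env k s₁ ∧ Productive env s₂) ∨
      ((∃ v, Nullable env s₁ v) ∧ InFirst env k s₂)
  | _, k, Syn.map _ s => InFirst env k s
  | _, _, _ => True

theorem fInv {A : Type} {k : Kind} {s : Syn Token Kind Var A}
    (h : InFirst env k s) : FInv env k s := by
  induction h with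
  | seqnL h₁ h₂ _ => exact Or.inl ⟨h₁, h₂⟩
  | seqnR h₁ h₂ _ => exact Or.inr ⟨⟨_, h₁⟩, h₂⟩
  | map f h _ => exact h
  | _ => trivial

def SInv : ∀ {A : Type}, Kind → Syn Token Kind Var A → Prop
  | _, _, Syn.eps _ => False
  | _, k, Syn.seqn s₁ s₂ => (InSNF env k s₁ ∧ ∃ v, Nullable env s₂ v) ∨
      (Productive env s₁ ∧ InSNF env k s₂)
  | _, k, Syn.map _ s => InSNF env k s
  | _, _, _ => True

theorem sInv {A : Type} {k : Kind} {s : Syn Token Kind Var A}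
    (h : InSNF env k s) : SInv env k s := by
  induction h with
  | seqnL h₁ h₂ _ => exact Or.inl ⟨h₁, _, h₂⟩
  | seqnR h₁ h₂ _ => exact Or.inr ⟨h₁, h₂⟩
  | map f h _ => exact h
  | _ => trivial

def CInv : ∀ {A : Type}, Syn Token Kind Var A → Prop
  | _, Syn.eps _ => False
  | _, Syn.seqn s₁ s₂ => (∃ k, InSNF env k s₁ ∧ InFirst env k s₂) ∨
      HasConflict env s₁ ∨ HasConflict env s₂
  | _, Syn.map _ s => HasConflict env s
  | _, _ => True

theorem cInv {A : Type} {s : Syn Token Kind Var A}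
    (h : HasConflict env s) : CInv env s := by
  induction h with
  | seqnSF h₁ h₂ => exact Or.inl ⟨_, h₁, h₂⟩
  | seqnL h _ => exact Or.inr (Or.inl h)
  | seqnR h _ => exact Or.inr (Or.inr h)
  | map f h _ => exact h
  | _ => trivial

theorem matches_productive {A : Type} {s : Syn Token Kind Var A} {ts : List Token} {v : A}
    (h : Matches kd env s ts v) : Productive env s := by
  induction h with
  | elem h => exact .elem _
  | eps v => exact .eps _
  | disjL _ ih => exact .disjL ih
  | disjR _ ih => exact .disjR ih
  | seqn _ _ i₁ i₂ => exact .seqn i₁ i₂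
  | map f _ ih => exact .map f ih
  | var x _ ih => exact .var x ih

theorem nullable_productive {A : Type} {s : Syn Token Kind Var A} {v : A}
    (h : Nullable env s v) : Productive env s := by
  induction h with
  | eps v => exact .eps _
  | disjL _ ih => exact .disjL ih
  | disjR _ ih => exact .disjR ih
  | seqn _ _ i₁ i₂ => exact .seqn i₁ i₂
  | map f _ ih => exact .map f ih
  | var x _ ih => exact .var x ih

theorem nullable_matches {A : Type} {s : Syn Token Kind Var A} {v : A}
    (h : Nullable env s v) : Matches kd env s [] v := by
  induction h with
  | eps v => exact .eps _
  | disjL _ ih => exact .disjL ih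
  | disjR _ ih => exact .disjR ih
  | seqn _ _ i₁ i₂ => exact .seqn (ts₁ := []) i₁ i₂
  | map f _ ih => exact .map f ih
  | var x _ ih => exact .var x ih

theorem matches_nullable {A : Type} {s : Syn Token Kind Var A} {ts : List Token} {v : A}
    (h : Matches kd env s ts v) : ts = [] → Nullable env s v := by
  induction h with
  | elem h => intro h; cases h
  | eps v => intro _; exact .eps _
  | disjL _ ih => intro h; exact .disjL (ih h)
  | disjR _ ih => intro h; exact .disjR (ih h)
  | seqn _ _ i₁ i₂ =>
    intro h
    rw [List.append_eq_nil_iff] at h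
    exact .seqn (i₁ h.1) (i₂ h.2)
  | map f _ ih => intro h; exact .map f (ih h)
  | var x _ ih => intro h; exact .var x (ih h)

theorem matches_first {A : Type} {s : Syn Token Kind Var A} {ts : List Token} {v : A}
    (h : Matches kd env s ts v) :
    ∀ t ts', ts = t :: ts' → InFirst env (kd t) s := by
  induction h with
  | elem h =>
    rintro t ts' e
    cases e
    subst h
    exact .elem _
  | eps v => intro t ts' e; cases e
  | disjL _ ih => intro t ts' e; exact .disjL (ih t ts' e)
  | disjR _ ih => intro t ts' e; exact .disjR (ih t ts' e)
  | @seqn A B s₁ s₂ ts₁ ts₂ v₁ v₂ h₁ h₂ i₁ i₂ =>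
    intro t ts' e
    cases ts₁ with
    | nil => exact .seqnR (matches_nullable kd env h₁ rfl) (i₂ t ts' e)
    | cons a l =>
      cases e
      exact .seqnL (i₁ _ _ rfl) (matches_productive kd env h₂)
  | map f _ ih => intro t ts' e; exact .map f (ih t ts' e)
  | var x _ ih => intro t ts' e; exact .var x (ih t ts' e)

/-- Inclusion of matches on sequences that are empty or start with `t`. -/
def MLe (t : Token) {A : Type} (s s' : Syn Token Kind Var A) : Prop :=
  (∀ v, Matches kd env s [] v → Matches kd env s' [] v) ∧
  (∀ ts v, Matches kd env s (t :: ts) v → Matches kd env s' (t :: ts) v)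

theorem MLe.unfocus {t : Token} {A B : Type} (c : Ctx Token Kind Var A B) :
    ∀ {s s' : Syn Token Kind Var A}, MLe kd env t s s' →
      MLe kd env t (unfocus s c) (unfocus s' c) := by
  induction c with
  | nil => intro s s' h; exact h
  | cons l c ih =>
    intro s s' h
    cases l with
    | apply f =>
      refine ih (s := Syn.map f s) (s' := Syn.map f s') ⟨?_, ?_⟩
      · intro v m
        obtain ⟨w, rfl, m₂⟩ := mInv kd env m
        exact .map f (h.1 _ m₂)
      · intro ts v m
        obtain ⟨w, rfl, m₂⟩ := mInv kd env m
        exact .map f (h.2 _ _ m₂)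
    | prepend x =>
      refine ih (s := Syn.seqn (Syn.eps x) s) (s' := Syn.seqn (Syn.eps x) s') ⟨?_, ?_⟩
      · rintro ⟨v₁, v₂⟩ m
        obtain ⟨ts₁, ts₂, e, m₁, m₂⟩ := mInv kd env m
        obtain ⟨rfl, _⟩ := mInv kd env m₁
        simp only [List.nil_append] at e
        subst e
        exact .seqn (ts₁ := []) m₁ (h.1 _ m₂)
      · rintro ts ⟨v₁, v₂⟩ m
        obtain ⟨ts₁, ts₂, e, m₁, m₂⟩ := mInv kd env m
        obtain ⟨rfl, _⟩ := mInv kd env m₁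
        simp only [List.nil_append] at e
        subst e
        exact .seqn (ts₁ := []) m₁ (h.2 _ _ m₂)
    | followBy u =>
      refine ih (s := Syn.seqn s u) (s' := Syn.seqn s' u) ⟨?_, ?_⟩
      · rintro ⟨v₁, v₂⟩ m
        obtain ⟨ts₁, ts₂, e, m₁, m₂⟩ := mInv kd env m
        obtain ⟨rfl, rfl⟩ := List.append_eq_nil_iff.1 e.symm
        exact .seqn (ts₁ := []) (h.1 _ m₁) m₂
      · rintro ts ⟨v₁, v₂⟩ m
        obtain ⟨ts₁, ts₂, e, m₁, m₂⟩ := mInv kd env m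
        rw [e]
        cases ts₁ with
        | nil => exact .seqn (h.1 _ m₁) m₂
        | cons a l =>
          cases e
          exact .seqn (h.2 _ _ m₁) m₂

theorem MLe.trans {t : Token} {A : Type} {s₁ s₂ s₃ : Syn Token Kind Var A}
    (h : MLe kd env t s₁ s₂) (h' : MLe kd env t s₂ s₃) : MLe kd env t s₁ s₃ :=
  ⟨fun v m => h'.1 v (h.1 v m), fun ts v m => h'.2 ts v (h.2 ts v m)⟩

theorem MLe.of_forall {t : Token} {A : Type} {s₁ s₂ : Syn Token Kind Var A}
    (h : ∀ ts v, Matches kd env s₁ ts v → Matches kd env s₂ ts v) : MLe kd env t s₁ s₂ :=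
  ⟨h _, fun ts => h _⟩

theorem plug_equiv {t : Token} {A B : Type} (c : Ctx Token Kind Var A B) : ∀ (v : A),
    MLe kd env t (unfocus (Syn.eps v) c) (unfocusF (plug v c)) ∧
    MLe kd env t (unfocusF (plug v c)) (unfocus (Syn.eps v) c) := by
  induction c with
  | nil => intro v; exact ⟨.of_forall _ _ fun _ _ h => h, .of_forall _ _ fun _ _ h => h⟩
  | cons l c ih =>
    intro v
    cases l with
    | apply f =>
      refine ⟨MLe.trans _ _ (MLe.unfocus kd env c (s := Syn.map f (Syn.eps v))
        (s' := Syn.eps (f v)) (.of_forall _ _ ?_)) (ih (f v)).1,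
        MLe.trans _ _ (ih (f v)).2 (MLe.unfocus kd env c (s' := Syn.map f (Syn.eps v))
        (s := Syn.eps (f v)) (.of_forall _ _ ?_))⟩
      · intro ts w m
        obtain ⟨w, rfl, m₂⟩ := mInv kd env m
        obtain ⟨rfl, rfl⟩ := mInv kd env m₂
        exact .eps _
      · intro ts w m
        obtain ⟨rfl, rfl⟩ := mInv kd env m
        exact .map f (.eps _)
    | prepend x =>
      refine ⟨MLe.trans _ _ (MLe.unfocus kd env c (s := Syn.seqn (Syn.eps x) (Syn.eps v))
        (s' := Syn.eps (x, v)) (.of_forall _ _ ?_)) (ih (x, v)).1,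
        MLe.trans _ _ (ih (x, v)).2 (MLe.unfocus kd env c
        (s' := Syn.seqn (Syn.eps x) (Syn.eps v))
        (s := Syn.eps (x, v)) (.of_forall _ _ ?_))⟩
      · rintro ts ⟨w₁, w₂⟩ m
        obtain ⟨ts₁, ts₂, rfl, m₁, m₂⟩ := mInv kd env m
        obtain ⟨rfl, e₁⟩ := mInv kd env m₁
        obtain ⟨rfl, e₂⟩ := mInv kd env m₂
        simp only at e₁ e₂
        subst e₁ e₂
        exact .eps _
      · intro ts w m
        obtain ⟨rfl, rfl⟩ := mInv kd env m
        exact .seqn (ts₁ := []) (.eps _) (.eps _)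
    | followBy u =>
      exact ⟨.of_forall _ _ fun _ _ h => h, .of_forall _ _ fun _ _ h => h⟩

/-- Inclusion of all the static properties. -/
structure PLe {A : Type} (s s' : Syn Token Kind Var A) : Prop where
  prod : Productive env s → Productive env s'
  null : ∀ v, Nullable env s v → Nullable env s' v
  first : ∀ k, InFirst env k s → InFirst env k s'
  snf : ∀ k, InSNF env k s → InSNF env k s'
  confl : HasConflict env s → HasConflict env s'

theorem PLe.refl {A : Type} (s : Syn Token Kind Var A) : PLe env s s :=
  ⟨id, fun _ => id, fun _ => id, fun _ => id, id⟩

theorem PLe.trans {A : Type} {s₁ s₂ s₃ : Syn Token Kind Var A}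
    (h : PLe env s₁ s₂) (h' : PLe env s₂ s₃) : PLe env s₁ s₃ :=
  ⟨fun x => h'.prod (h.prod x), fun v x => h'.null v (h.null v x),
   fun v x => h'.first v (h.first v x), fun v x => h'.snf v (h.snf v x),
   fun x => h'.confl (h.confl x)⟩

theorem PLe.eps {A : Type} {s : Syn Token Kind Var A} {v : A} (h : Nullable env s v) :
    PLe env (Syn.eps v) s where
  prod _ := nullable_productive env h
  null w hw := by
    have e : w = v := nInv env hw
    rw [e]; exact h
  first k hk := (fInv env hk).elim
  snf k hk := (sInv env hk).elim
  confl hk := (cInv env hk).elim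

theorem PLe.map {A B : Type} (f : A → B) {s s' : Syn Token Kind Var A} (h : PLe env s s') :
    PLe env (Syn.map f s) (Syn.map f s') where
  prod x := .map f (h.prod (pInv env x))
  null w hw := by
    obtain ⟨u, rfl, hu⟩ := nInv env hw
    exact .map f (h.null _ hu)
  first k hk := .map f (h.first _ (fInv env hk))
  snf k hk := .map f (h.snf _ (sInv env hk))
  confl hk := .map f (h.confl (cInv env hk))

theorem PLe.seqn {A B : Type} {s s' : Syn Token Kind Var A} {u u' : Syn Token Kind Var B}
    (h : PLe env s s') (g : PLe env u u') :
    PLe env (Syn.seqn s u) (Syn.seqn s' u') where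
  prod x := .seqn (h.prod (pInv env x).1) (g.prod (pInv env x).2)
  null w hw := .seqn (h.null _ (nInv env hw).1) (g.null _ (nInv env hw).2)
  first k hk := by
    rcases fInv env hk with ⟨a, b⟩ | ⟨⟨v, a⟩, b⟩
    · exact .seqnL (h.first _ a) (g.prod b)
    · exact .seqnR (h.null _ a) (g.first _ b)
  snf k hk := by
    rcases sInv env hk with ⟨a, v, b⟩ | ⟨a, b⟩
    · exact .seqnL (h.snf _ a) (g.null _ b)
    · exact .seqnR (h.prod a) (g.snf _ b)
  confl hk := by
    rcases cInv env hk with ⟨k, a, b⟩ | a | a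
    · exact .seqnSF (h.snf _ a) (g.first _ b)
    · exact .seqnL (h.confl a)
    · exact .seqnR (g.confl a)

theorem PLe.unfocus {A B : Type} (c : Ctx Token Kind Var A B) :
    ∀ {s s' : Syn Token Kind Var A}, PLe env s s' →
      PLe env (unfocus s c) (unfocus s' c) := by
  induction c with
  | nil => intro s s' h; exact h
  | cons l c ih =>
    intro s s' h
    cases l with
    | apply f => exact ih (h.map env f)
    | prepend x => exact ih (PLe.seqn env (.refl env _) h)
    | followBy u => exact ih (PLe.seqn env h (.refl env _))

theorem plug_ple {A B : Type} (c : Ctx Token Kind Var A B) : ∀ (v : A),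
    PLe env (unfocusF (plug v c)) (unfocus (Syn.eps v) c) := by
  induction c with
  | nil => intro v; exact .refl env _
  | cons l c ih =>
    intro v
    cases l with
    | apply f =>
      exact PLe.trans env (ih (f v)) (PLe.unfocus env c (.eps env (.map f (.eps v))))
    | prepend x =>
      exact PLe.trans env (ih (x, v)) (PLe.unfocus env c (.eps env (.seqn (.eps x) (.eps v))))
    | followBy u => exact .refl env _

theorem conflict_unfocus {A B : Type} (c : Ctx Token Kind Var A B) :
    ∀ {s : Syn Token Kind Var A}, HasConflict env s → HasConflict env (unfocus s c) := by
  induction c with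
  | nil => intro s h; exact h
  | cons l c ih =>
    intro s h
    cases l with
    | apply f => exact ih (.map f h)
    | prepend x => exact ih (.seqnR h)
    | followBy u => exact ih (.seqnL h)

def Layer.wt : ∀ {A B : Type}, Layer Token Kind Var A B → ℕ
  | _, _, Layer.apply _ => 1
  | _, _, Layer.prepend _ => 1
  | _, _, Layer.followBy _ => 2

def Ctx.wt : ∀ {A B : Type}, Ctx Token Kind Var A B → ℕ
  | _, _, Ctx.nil => 0
  | _, _, Ctx.cons l c => l.wt + c.wt

theorem plug_wt {A B : Type} (c : Ctx Token Kind Var A B) : ∀ (v : A),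
    (plug v c).2.2.wt ≤ c.wt ∧ (c.isNil = false → (plug v c).2.2.wt < c.wt) := by
  induction c with
  | nil => intro v; exact ⟨le_refl _, fun h => by cases h⟩
  | cons l c ih =>
    intro v
    cases l with
    | apply f =>
      have := (ih (f v)).1
      simp only [plug, Ctx.wt, Layer.wt]
      exact ⟨by omega, fun _ => by omega⟩
    | prepend x =>
      have := (ih (x, v)).1
      simp only [plug, Ctx.wt, Layer.wt]
      exact ⟨by omega, fun _ => by omega⟩
    | followBy u =>
      simp only [plug, Ctx.wt, Layer.wt]
      exact ⟨by omega, fun _ => by omega⟩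

end Helpers

section

variable {Token Kind : Type} {Var : Type → Type}
variable (kd : Token → Kind) (env : ∀ A : Type, Var A → Syn Token Kind Var A)

theorem locate_some_equiv
    (nullOpt : ∀ {A : Type}, Syn Token Kind Var A → Option A)
    (hnull : ∀ {A : Type} (s : Syn Token Kind Var A), ¬ HasConflict env s →
      ∀ v : A, nullOpt s = some v ↔ Nullable env s v)
    (locate : ∀ {B : Type}, Kind → Focused Token Kind Var B →
      Option (Focused Token Kind Var B))
    (hlocate_first : ∀ {A B : Type} (k : Kind) (s : Syn Token Kind Var A)
      (c : Ctx Token Kind Var A B), InFirst env k s →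
      locate k (⟨A, s, c⟩ : Focused Token Kind Var B) =
        some (⟨A, s, c⟩ : Focused Token Kind Var B))
    (hlocate_plug : ∀ {A B : Type} (k : Kind) (s : Syn Token Kind Var A)
      (c : Ctx Token Kind Var A B) (v : A),
      ¬ InFirst env k s → nullOpt s = some v → c.isNil = false →
      locate k (⟨A, s, c⟩ : Focused Token Kind Var B) = locate k (plug v c))
    (hlocate_none₁ : ∀ {A B : Type} (k : Kind) (s : Syn Token Kind Var A)
      (c : Ctx Token Kind Var A B),
      ¬ InFirst env k s → nullOpt s = none →
      locate k (⟨A, s, c⟩ : Focused Token Kind Var B) = none)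
    (hlocate_none₂ : ∀ {A : Type} (k : Kind) (s : Syn Token Kind Var A),
      ¬ InFirst env k s →
      locate k (⟨A, s, Ctx.nil⟩ : Focused Token Kind Var A) = none)
    {A B : Type} (s : Syn Token Kind Var A) (c : Ctx Token Kind Var A B)
    (t : Token) (k : Kind) (hk : kd t = k)
    (hll1 : ¬ HasConflict env (unfocus s c)) (fs' : Focused Token Kind Var B)
    (h : locate k (⟨A, s, c⟩ : Focused Token Kind Var B) = some fs')
    (ts : List Token) (v : B) :
    Matches kd env (unfocusF fs') (t :: ts) v ↔
      Matches kd env (unfocus s c) (t :: ts) v := by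
  obtain ⟨n, hn⟩ : ∃ n, c.wt = n := ⟨_, rfl⟩
  induction n using Nat.strong_induction_on generalizing A s c with
  | _ n ih =>
    by_cases hf : InFirst env k s
    · rw [hlocate_first k s c hf] at h
      cases h
      exact Iff.rfl
    · cases ho : nullOpt s with
      | none => rw [hlocate_none₁ k s c hf ho] at h; cases h
      | some w =>
        have hs : ¬ HasConflict env s := fun x => hll1 (conflict_unfocus env c x)
        have hw : Nullable env s w := (hnull s hs w).1 ho
        cases hc : c.isNil with
        | true =>
          cases c with
          | nil => rw [hlocate_none₂ k s hf] at h; cases h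
          | cons l c => cases hc
        | false =>
          rw [hlocate_plug k s c w hf ho hc] at h
          have key := ih _ (hn ▸ (plug_wt c w).2 hc) (plug w c).2.1 (plug w c).2.2
            (fun x => hll1 ((PLe.trans env (plug_ple env c w)
              (PLe.unfocus env c (.eps env hw))).confl x)) h rfl
          have e₁ : MLe kd env t s (Syn.eps w) := by
            refine ⟨fun u m => ?_, fun ts u m => ?_⟩
            · have hu := (hnull s hs u).2 (matches_nullable kd env m rfl)
              rw [ho] at hu
              cases hu
              exact .eps _
            · exact absurd (hk ▸ matches_first kd env m t ts rfl) hf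
          have e₂ : MLe kd env t (Syn.eps w) s := by
            refine ⟨fun u m => ?_, fun ts u m => ?_⟩
            · obtain ⟨_, rfl⟩ := mInv kd env m
              exact nullable_matches kd env hw
            · obtain ⟨hh, _⟩ := mInv kd env m
              cases hh
          refine key.trans ⟨fun m => ?_, fun m => ?_⟩
          · exact (MLe.unfocus kd env c e₂).2 _ _ ((plug_equiv kd env c w).2.2 _ _ m)
          · exact (plug_equiv kd env c w).1.2 _ _ ((MLe.unfocus kd env c e₁).2 _ _ m)


end
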